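/- For every p ∈ {0} ∪ [1,∞), the closure in L_p(λ^N; ℝ^N) of the set L^quantile_p(λ^N) = {Q^μ : μ ∈ P_p(ℝ^N)} of p-integrable quantile processes equals the set L^IT_p(λ^N) of p-integrable triangular increasing maps. In particular the completion of (P_p(ℝ^N), KR_p) is, up to isometry, L^IT_p(λ^N). -/

import Mathlib

open MeasureTheory ProbabilityTheory Filter Set
open scoped ENNReal NNReal Topology

/-- Lebesgue measure on `(0,1)`. -/
noncomputable def lambda01 : Measure ℝ := volume.restrict (Set.Ioo (0:ℝ) 1)

/-- The `N`-fold product of Lebesgue measure on `(0,1)`. -/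
noncomputable def lambdaN (N : ℕ) : Measure (Fin N → ℝ) :=
  Measure.pi fun _ => lambda01

/-- The open unit cube `(0,1)^N`. -/
def cube (N : ℕ) : Set (Fin N → ℝ) := {u | ∀ i, u i ∈ Set.Ioo (0:ℝ) 1}

/-- A map is triangular (adapted) if its `k`-th component depends only on the first `k`
coordinates. -/
def Triangular {N : ℕ} (Q : (Fin N → ℝ) → Fin N → ℝ) : Prop :=
  ∀ (k : Fin N) (u v : Fin N → ℝ), (∀ j ≤ k, u j = v j) → Q u k = Q v k

/-- Monotonicity condition (inc) on a set `s`: the `k`-th component is increasing in the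
`k`-th coordinate (the earlier coordinates being fixed). -/
def IncOn {N : ℕ} (Q : (Fin N → ℝ) → Fin N → ℝ) (s : Set (Fin N → ℝ)) : Prop :=
  ∀ k : Fin N, ∀ u ∈ s, ∀ v ∈ s, (∀ j < k, u j = v j) → u k ≤ v k → Q u k ≤ Q v k

/-- Strict monotonicity condition (sinc) on a set `s`. -/
def StrictIncOn {N : ℕ} (Q : (Fin N → ℝ) → Fin N → ℝ) (s : Set (Fin N → ℝ)) : Prop :=
  ∀ k : Fin N, ∀ u ∈ s, ∀ v ∈ s, (∀ j < k, u j = v j) → u k < v k → Q u k < Q v k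

/-- Consistency condition (con) on a set `s`: if changing only the `k`-th coordinate does not
change the `k`-th component, then it does not change any later component `m ≥ k`. -/
def ConOn {N : ℕ} (Q : (Fin N → ℝ) → Fin N → ℝ) (s : Set (Fin N → ℝ)) : Prop :=
  ∀ k m : Fin N, k ≤ m → ∀ u ∈ s, ∀ v ∈ s, (∀ j ≠ k, u j = v j) →
    Q u k = Q v k → Q u m = Q v m

/-- A quantile process: a Borel triangular map satisfying (inc) and (con) on the unit cube. -/
structure IsQuantileProcess {N : ℕ} (Q : (Fin N → ℝ) → Fin N → ℝ) : Prop where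
  measurable : Measurable Q
  triangular : Triangular Q
  inc : IncOn Q (cube N)
  con : ConOn Q (cube N)

/-- The (a.e. unique) quantile process of `μ`, chosen via Hilbert's epsilon operator. -/
noncomputable def quantileProcess {N : ℕ} (μ : Measure (Fin N → ℝ)) :
    (Fin N → ℝ) → Fin N → ℝ :=
  Classical.epsilon fun Q => IsQuantileProcess Q ∧ (lambdaN N).map Q = μ

/-- The cost `|x - y|_p^p = ∑ₖ |xₖ - yₖ|^p`, valued in `ℝ≥0∞`. -/
noncomputable def pCost (p : ℝ) {N : ℕ} (x y : Fin N → ℝ) : ℝ≥0∞ :=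
  ∑ k, ENNReal.ofReal (|x k - y k| ^ p)

/-- The bounded cost `|x - y| ∧ 1` used for `p = 0`. -/
noncomputable def cost0 {N : ℕ} (x y : Fin N → ℝ) : ℝ≥0∞ :=
  ENNReal.ofReal (min ‖x - y‖ 1)

/-- The `L_p(λ^N; ℝ^N)`-distance of two maps `(0,1)^N → ℝ^N`
(for `p = 0` the distance `∫ |f - g| ∧ 1 dλ^N` of convergence in probability). -/
noncomputable def Ldist (p : ℝ) {N : ℕ} (f g : (Fin N → ℝ) → Fin N → ℝ) : ℝ≥0∞ :=
  if p = 0 then ∫⁻ u, cost0 (f u) (g u) ∂(lambdaN N)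
  else (∫⁻ u, pCost p (f u) (g u) ∂(lambdaN N)) ^ p⁻¹

/-- `μ ∈ P_p(ℝ^N)`: a Borel probability measure with finite `p`-th moments
(no moment condition when `p = 0`). -/
def MemPp (p : ℝ) {N : ℕ} (μ : Measure (Fin N → ℝ)) : Prop :=
  IsProbabilityMeasure μ ∧
    (p = 0 ∨ ∫⁻ x, ∑ k, ENNReal.ofReal (|x k| ^ p) ∂μ < ⊤)

/-- `T` is `p`-integrable w.r.t. `λ^N` (no condition when `p = 0`). -/
def FinLp (p : ℝ) {N : ℕ} (T : (Fin N → ℝ) → Fin N → ℝ) : Prop :=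
  p = 0 ∨ ∫⁻ u, ∑ k, ENNReal.ofReal (|T u k| ^ p) ∂(lambdaN N) < ⊤

/-- The Knothe–Rosenblatt distance `KR_p(μ,ν)` (for `p = 0` the metric
`∫ |Q^μ - Q^ν| ∧ 1 dλ^N`). -/
noncomputable def KRdist (p : ℝ) {N : ℕ} (μ ν : Measure (Fin N → ℝ)) : ℝ≥0∞ :=
  Ldist p (quantileProcess μ) (quantileProcess ν)

/-- An increasing triangular transformation: a Borel triangular map satisfying (inc) on a
`λ^N`-full subset of the unit cube. -/
def IncreasingTriangular {N : ℕ} (T : (Fin N → ℝ) → Fin N → ℝ) : Prop :=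
  Measurable T ∧ Triangular T ∧
    ∃ Γ : Set (Fin N → ℝ), Γ ⊆ cube N ∧ lambdaN N Γᶜ = 0 ∧ IncOn T Γ

/-- A strictly increasing triangular transformation: a Borel triangular map satisfying (sinc)
on a `λ^N`-full subset of the unit cube. -/
def StrictlyIncreasingTriangular {N : ℕ} (T : (Fin N → ℝ) → Fin N → ℝ) : Prop :=
  Measurable T ∧ Triangular T ∧
    ∃ Γ : Set (Fin N → ℝ), Γ ⊆ cube N ∧ lambdaN N Γᶜ = 0 ∧ StrictIncOn T Γ

instance : IsProbabilityMeasure lambda01 := ⟨by simp [lambda01]⟩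

instance (N : ℕ) : IsProbabilityMeasure (lambdaN N) := by
  unfold lambdaN; infer_instance

lemma lambda01_Iic {c : ℝ} (h1 : c ≤ 1) : lambda01 (Iic c) = ENNReal.ofReal c := by
  rw [lambda01, Measure.restrict_congr_set Ioo_ae_eq_Ioc, Measure.restrict_apply measurableSet_Iic]
  have : Iic c ∩ Ioc (0 : ℝ) 1 = Ioc 0 c := by
    ext x
    simp only [mem_inter_iff, mem_Iic, mem_Ioc]
    constructor
    · rintro ⟨h, h', -⟩; exact ⟨h', h⟩
    · rintro ⟨h, h'⟩; exact ⟨h', h, h'.trans h1⟩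
  rw [this, Real.volume_Ioc, sub_zero]

/-- The generalized inverse of the distribution function of `f` under Lebesgue measure
on `(0,1)`, i.e. the increasing rearrangement of `f`. -/
noncomputable def lowerQuantile (f : ℝ → ℝ) (t : ℝ) : ℝ :=
  sInf {x | t ≤ cdf (lambda01.map f) x}

lemma ofReal_cdf_map {f : ℝ → ℝ} (hf : Measurable f) (x : ℝ) :
    ENNReal.ofReal (cdf (lambda01.map f) x) = lambda01 {s | f s ≤ x} := by
  have : IsProbabilityMeasure (lambda01.map f) := Measure.isProbabilityMeasure_map hf.aemeasurable
  rw [ofReal_cdf, Measure.map_apply hf measurableSet_Iic]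
  rfl

lemma lowerQuantile_le_iff {f : ℝ → ℝ} {t : ℝ} (ht : t ∈ Ioo (0 : ℝ) 1) (x : ℝ) :
    lowerQuantile f t ≤ x ↔ t ≤ cdf (lambda01.map f) x := by
  set F := cdf (lambda01.map f)
  have hne : {x | t ≤ F x}.Nonempty := by
    obtain ⟨y, hy⟩ := ((tendsto_cdf_atTop (lambda01.map f)).eventually_const_le ht.2).exists
    exact ⟨y, hy⟩
  have hbdd : BddBelow {x | t ≤ F x} := by
    obtain ⟨y, hy⟩ := ((tendsto_cdf_atBot (lambda01.map f)).eventually_lt_const ht.1).exists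
    refine ⟨y, fun z hz => ?_⟩
    by_contra! hlt
    exact absurd (le_trans hz (F.mono hlt.le)) (not_le.2 hy)
  constructor
  · intro h
    have hev : ∀ y > x, t ≤ F y := by
      intro y hy
      obtain ⟨z, hz, hzy⟩ := exists_lt_of_csInf_lt hne (lt_of_le_of_lt h hy)
      exact le_trans hz (F.mono hzy.le)
    have hcont : Tendsto F (𝓝[>] x) (𝓝 (F x)) :=
      (F.right_continuous x).mono_left (nhdsWithin_mono _ Ioi_subset_Ici_self)
    exact ge_of_tendsto hcont (eventually_nhdsWithin_of_forall hev)
  · intro h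
    exact csInf_le hbdd h

lemma lowerQuantile_mono {f : ℝ → ℝ} {s t : ℝ} (hs : s ∈ Ioo (0 : ℝ) 1) (ht : t ∈ Ioo (0 : ℝ) 1)
    (hst : s ≤ t) : lowerQuantile f s ≤ lowerQuantile f t :=
  (lowerQuantile_le_iff hs _).2 (hst.trans ((lowerQuantile_le_iff ht _).1 le_rfl))

/-- A function that is increasing on a set of full measure agrees almost everywhere with its
increasing rearrangement. -/
lemma ae_eq_lowerQuantile {f : ℝ → ℝ} (hf : Measurable f) {A : Set ℝ}
    (hA : ∀ᵐ t ∂lambda01, t ∈ A) (hmono : MonotoneOn f A) :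
    f =ᵐ[lambda01] lowerQuantile f := by
  have hI : ∀ᵐ t ∂lambda01, t ∈ Ioo (0 : ℝ) 1 := ae_restrict_mem measurableSet_Ioo
  have hprob : IsProbabilityMeasure (lambda01.map f) :=
    Measure.isProbabilityMeasure_map hf.aemeasurable
  have hle : ∀ᵐ t ∂lambda01, lowerQuantile f t ≤ f t := by
    filter_upwards [hI, hA] with t ht htA
    rw [lowerQuantile_le_iff ht, ← ENNReal.ofReal_le_ofReal_iff (cdf_nonneg _ _),
      ofReal_cdf_map hf, ← lambda01_Iic ht.2.le]
    refine measure_mono_ae ?_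
    filter_upwards [hA] with s hsA hst
    exact hmono hsA htA hst
  have hge : ∀ q : ℚ, ∀ᵐ t ∂lambda01, lowerQuantile f t ≤ q → f t ≤ q := by
    intro q
    have hsub : {t | f t ≤ (q : ℝ)} ≤ᵐ[lambda01] Iic (cdf (lambda01.map f) q) := by
      filter_upwards [hI, hle] with t ht h htq
      exact (lowerQuantile_le_iff ht _).1 (h.trans htq)
    have heq := ae_eq_of_ae_subset_of_measure_ge hsub
      (by rw [lambda01_Iic (cdf_le_one _ _), ofReal_cdf_map hf])
      (measurableSet_le hf measurable_const).nullMeasurableSet (measure_ne_top _ _)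
    filter_upwards [hI, heq.mem_iff] with t ht h hq
    exact h.2 ((lowerQuantile_le_iff ht _).1 hq)
  filter_upwards [hle, ae_all_iff.2 hge] with t h1 h2
  refine le_antisymm (le_of_forall_gt_imp_ge_of_dense fun a ha => ?_) h1
  obtain ⟨q, hq1, hq2⟩ := exists_rat_btwn ha
  exact (h2 q hq1.le).trans hq2.le

lemma measurable_update_prod {N : ℕ} (k : Fin N) :
    Measurable fun z : (Fin N → ℝ) × ℝ => Function.update z.1 k z.2 := by
  refine measurable_pi_lambda _ fun j => ?_
  by_cases h : j = k
  · subst h; simpa using measurable_snd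
  · simpa [Function.update_of_ne h, Function.comp_def] using
      (measurable_pi_apply j).comp measurable_fst

/-- Resampling one coordinate preserves the product measure. -/
lemma measurePreserving_update {N : ℕ} (k : Fin N) :
    MeasurePreserving (fun z : (Fin N → ℝ) × ℝ => Function.update z.1 k z.2)
      ((lambdaN N).prod lambda01) (lambdaN N) := by
  refine ⟨measurable_update_prod k, ?_⟩
  symm
  refine Measure.pi_eq fun s hs => ?_
  rw [Measure.map_apply (measurable_update_prod k) (MeasurableSet.univ_pi hs)]
  have : (fun z : (Fin N → ℝ) × ℝ => Function.update z.1 k z.2) ⁻¹' (univ.pi s)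
      = (univ.pi (Function.update s k univ)) ×ˢ (s k) := by
    ext ⟨u, t⟩
    simp only [mem_preimage, Set.mem_pi, mem_univ, true_implies, mem_prod]
    constructor
    · intro h
      refine ⟨fun j => ?_, by simpa using h k⟩
      by_cases hj : j = k
      · subst hj; simp
      · simpa [Function.update_of_ne hj] using h j
    · rintro ⟨h, hk⟩ j
      by_cases hj : j = k
      · subst hj; simpa using hk
      · simpa [Function.update_of_ne hj] using h j
  rw [this, Measure.prod_prod, lambdaN, Measure.pi_pi,
    ← Finset.prod_erase_mul _ _ (Finset.mem_univ k),
    ← Finset.prod_erase_mul _ (fun i => lambda01 (s i)) (Finset.mem_univ k)]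
  simp only [Function.update_self, measure_univ, mul_one]
  congr 1
  refine Finset.prod_congr rfl fun j hj => ?_
  rw [Function.update_of_ne (Finset.ne_of_mem_erase hj)]

open Classical in
/-- The coordinatewise conditional increasing rearrangement of a triangular map. -/
noncomputable def rearrange {N : ℕ} (S : (Fin N → ℝ) → Fin N → ℝ) (u : Fin N → ℝ) (k : Fin N) : ℝ :=
  if u k ∈ Ioo (0 : ℝ) 1 then lowerQuantile (fun t => S (Function.update u k t) k) (u k) else 0

lemma measurable_section {N : ℕ} {S : (Fin N → ℝ) → Fin N → ℝ} (hS : Measurable S) (k : Fin N)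
    (u : Fin N → ℝ) : Measurable fun t => S (Function.update u k t) k :=
  (measurable_pi_apply k).comp (hS.comp (measurable_update u))

lemma measurable_rearrange {N : ℕ} {S : (Fin N → ℝ) → Fin N → ℝ} (hS : Measurable S) :
    Measurable (rearrange S) := by
  refine measurable_pi_lambda _ fun k => measurable_of_Iic fun x => ?_
  have hG : Measurable fun u : Fin N → ℝ =>
      lambda01 {t | S (Function.update u k t) k ≤ x} := by
    have hm : MeasurableSet {z : (Fin N → ℝ) × ℝ | S (Function.update z.1 k z.2) k ≤ x} :=
      measurableSet_le ((measurable_pi_apply k).comp (hS.comp (measurable_update_prod k)))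
        measurable_const
    exact measurable_measure_prodMk_left hm
  have hk : MeasurableSet {u : Fin N → ℝ | u k ∈ Ioo (0 : ℝ) 1} :=
    measurable_pi_apply k measurableSet_Ioo
  have : (fun u => rearrange S u k) ⁻¹' Iic x
      = ({u : Fin N → ℝ | u k ∈ Ioo (0 : ℝ) 1} ∩ {u | ENNReal.ofReal (u k) ≤
          lambda01 {t | S (Function.update u k t) k ≤ x}}) ∪
        ({u : Fin N → ℝ | u k ∈ Ioo (0 : ℝ) 1}ᶜ ∩ {_u | (0 : ℝ) ≤ x}) := by
    ext u
    by_cases h : u k ∈ Ioo (0 : ℝ) 1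
    · have hmem : u ∈ {u : Fin N → ℝ | u k ∈ Ioo (0 : ℝ) 1} := h
      simp only [mem_preimage, mem_Iic, rearrange, if_pos h, mem_union, mem_inter_iff, hmem,
        true_and, mem_compl_iff, not_true_eq_false, false_and, or_false, mem_ofPred_eq]
      rw [lowerQuantile_le_iff h, ← ofReal_cdf_map (measurable_section hS k u),
        ENNReal.ofReal_le_ofReal_iff (cdf_nonneg _ _)]
    · have hmem : u ∉ {u : Fin N → ℝ | u k ∈ Ioo (0 : ℝ) 1} := h
      simp only [mem_preimage, mem_Iic, rearrange, if_neg h, mem_union, mem_inter_iff, hmem,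
        false_and, mem_compl_iff, not_false_eq_true, true_and, false_or, mem_ofPred_eq]
  rw [this]
  exact (hk.inter
    (measurableSet_le (ENNReal.measurable_ofReal.comp (measurable_pi_apply k)) hG)).union
    (hk.compl.inter (MeasurableSet.const _))

lemma section_congr {N : ℕ} {S : (Fin N → ℝ) → Fin N → ℝ} (hS : Triangular S) {k : Fin N}
    {u v : Fin N → ℝ} (h : ∀ j < k, u j = v j) :
    (fun t => S (Function.update u k t) k) = fun t => S (Function.update v k t) k := by
  funext t
  refine hS k _ _ fun j hj => ?_
  by_cases hjk : j = k
  · subst hjk; simp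
  · simp [Function.update_of_ne hjk, h j (lt_of_le_of_ne hj hjk)]

lemma triangular_rearrange {N : ℕ} {S : (Fin N → ℝ) → Fin N → ℝ} (hS : Triangular S) :
    Triangular (rearrange S) := by
  intro k u v h
  simp only [rearrange, section_congr hS fun j hj => h j hj.le, h k le_rfl]

lemma incOn_rearrange {N : ℕ} {S : (Fin N → ℝ) → Fin N → ℝ} (hS : Triangular S) :
    IncOn (rearrange S) (cube N) := by
  intro k u hu v hv h hk
  simp only [rearrange, section_congr hS h, if_pos (hu k), if_pos (hv k)]
  exact lowerQuantile_mono (hu k) (hv k) hk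

lemma rearrange_ae_eq {N : ℕ} {S : (Fin N → ℝ) → Fin N → ℝ} (hS : IncreasingTriangular S) :
    rearrange S =ᵐ[lambdaN N] S := by
  obtain ⟨hm, -, Γ, -, hΓ0, hinc⟩ := hS
  suffices h : ∀ k : Fin N, ∀ᵐ u ∂lambdaN N, rearrange S u k = S u k by
    filter_upwards [ae_all_iff.2 h] with u hu
    exact funext hu
  intro k
  have hmp := measurePreserving_update k
  have hE : MeasurableSet {u | rearrange S u k = S u k} :=
    measurableSet_eq_fun ((measurable_pi_apply k).comp (measurable_rearrange hm))
      ((measurable_pi_apply k).comp hm)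
  have hΓ : ∀ᵐ u ∂lambdaN N, ∀ᵐ t ∂lambda01, Function.update u k t ∈ Γ :=
    Measure.ae_ae_of_ae_prod (hmp.quasiMeasurePreserving.ae (mem_ae_iff.2 hΓ0))
  rw [← hmp.map_eq, ae_map_iff hmp.measurable.aemeasurable hE]
  refine (Measure.ae_prod_iff_ae_ae (hmp.measurable hE)).2 ?_
  filter_upwards [hΓ] with u hu
  have hq := ae_eq_lowerQuantile (measurable_section hm k u) hu (by
    intro s hs t ht hst
    refine hinc k _ hs _ ht (fun j hj => ?_) (by simpa using hst)
    simp [Function.update_of_ne hj.ne])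
  filter_upwards [hq, (ae_restrict_mem measurableSet_Ioo : ∀ᵐ t ∂lambda01, t ∈ Ioo (0 : ℝ) 1)]
    with t ht htI
  simp only [rearrange, Function.update_self, if_pos htI, Function.update_idem]
  exact ht.symm

lemma ae_mem_cube (N : ℕ) : ∀ᵐ u ∂lambdaN N, u ∈ cube N := by
  refine ae_all_iff.2 fun k => ?_
  exact (measurePreserving_eval (fun _ : Fin N => lambda01) k).quasiMeasurePreserving.ae
    (ae_restrict_mem measurableSet_Ioo)

/-- Adding a positive multiple of the identity to an increasing triangular map makes it strictly
increasing, hence a quantile process. -/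
lemma isQuantileProcess_add_smul {N : ℕ} {R : (Fin N → ℝ) → Fin N → ℝ} (hm : Measurable R)
    (ht : Triangular R) (hi : IncOn R (cube N)) {δ : ℝ} (hδ : 0 < δ) :
    IsQuantileProcess fun u => R u + δ • u where
  measurable := hm.add (measurable_id.const_smul δ)
  triangular k u v h := by simp [ht k u v h, h k le_rfl]
  inc k u hu v hv h hk := by
    have := hi k u hu v hv h hk
    simp only [Pi.add_apply, Pi.smul_apply, smul_eq_mul]
    gcongr
  con k m _ u hu v hv h hk := by
    have key : ∀ u ∈ cube N, ∀ v ∈ cube N, (∀ j ≠ k, u j = v j) →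
        (R u + δ • u) k = (R v + δ • v) k → v k ≤ u k := by
      intro u hu v hv h hk
      by_contra! hlt
      have h1 := hi k u hu v hv (fun j hj => h j hj.ne) hlt.le
      have h2 := mul_lt_mul_of_pos_left hlt hδ
      simp only [Pi.add_apply, Pi.smul_apply, smul_eq_mul] at hk
      linarith
    have huv : u = v := by
      funext j
      by_cases hj : j = k
      · subst hj
        exact le_antisymm (key v hv u hu (fun i hi => (h i hi).symm) hk.symm) (key u hu v hv h hk)
      · exact h j hj
    rw [huv]

/-- Two maps at a.e. coordinatewise distance at most `δ` are close in `Ldist`. -/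
lemma Ldist_le {N : ℕ} {p : ℝ} (hp : p = 0 ∨ 1 ≤ p) {f g : (Fin N → ℝ) → Fin N → ℝ} {δ : ℝ}
    (hδ : 0 ≤ δ) (h : ∀ᵐ u ∂lambdaN N, ∀ k, |f u k - g u k| ≤ δ) :
    Ldist p f g ≤ ((N : ℝ≥0∞) ^ p⁻¹ + 1) * ENNReal.ofReal δ := by
  unfold Ldist
  split_ifs with hp0
  · calc ∫⁻ u, cost0 (f u) (g u) ∂lambdaN N ≤ ∫⁻ _, ENNReal.ofReal δ ∂lambdaN N := by
          refine lintegral_mono_ae ?_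
          filter_upwards [h] with u hu
          refine ENNReal.ofReal_le_ofReal ((min_le_left _ _).trans ?_)
          exact (pi_norm_le_iff_of_nonneg hδ).2 fun k => by simpa using hu k
      _ = 1 * ENNReal.ofReal δ := by simp
      _ ≤ _ := by gcongr; exact le_add_self
  · have hp1 : 1 ≤ p := hp.resolve_left hp0
    have hp' : 0 < p := by linarith
    calc (∫⁻ u, pCost p (f u) (g u) ∂lambdaN N) ^ p⁻¹
        ≤ (∫⁻ _, (N : ℝ≥0∞) * ENNReal.ofReal δ ^ p ∂lambdaN N) ^ p⁻¹ := by
          refine ENNReal.rpow_le_rpow (lintegral_mono_ae ?_) (by positivity)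
          filter_upwards [h] with u hu
          calc pCost p (f u) (g u) ≤ ∑ _k : Fin N, ENNReal.ofReal δ ^ p := by
                refine Finset.sum_le_sum fun k _ => ?_
                rw [ENNReal.ofReal_rpow_of_nonneg hδ hp'.le]
                exact ENNReal.ofReal_le_ofReal
                  (Real.rpow_le_rpow (abs_nonneg _) (hu k) hp'.le)
            _ = _ := by simp
      _ = (N : ℝ≥0∞) ^ p⁻¹ * ENNReal.ofReal δ := by
          rw [lintegral_const, measure_univ, mul_one,
            ENNReal.mul_rpow_of_nonneg _ _ (by positivity), ← ENNReal.rpow_mul,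
            mul_inv_cancel₀ hp'.ne', ENNReal.rpow_one]
      _ ≤ _ := by gcongr; exact le_self_add

lemma FinLp.of_ae_abs_sub_le {N : ℕ} {p : ℝ} (hp : p = 0 ∨ 1 ≤ p) {f g : (Fin N → ℝ) → Fin N → ℝ}
    {δ : ℝ} (hδ : 0 ≤ δ) (h : ∀ᵐ u ∂lambdaN N, ∀ k, |f u k - g u k| ≤ δ) (hf : FinLp p f) :
    FinLp p g := by
  rcases hp with hp | hp
  · exact Or.inl hp
  have hp' : 0 < p := by linarith
  rcases hf with hf | hf
  · exact Or.inl hf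
  refine Or.inr (lt_of_le_of_lt (b := ∫⁻ u, (2 : ℝ≥0∞) ^ (p - 1) *
    ((∑ k, ENNReal.ofReal (|f u k| ^ p)) + N * ENNReal.ofReal δ ^ p) ∂lambdaN N) ?_ ?_)
  · refine lintegral_mono_ae ?_
    filter_upwards [h] with u hu
    have : (N : ℝ≥0∞) * ENNReal.ofReal δ ^ p = ∑ _k : Fin N, ENNReal.ofReal δ ^ p := by simp
    rw [this, ← Finset.sum_add_distrib, Finset.mul_sum]
    refine Finset.sum_le_sum fun k _ => ?_
    have hk : |g u k| ≤ |f u k| + δ := by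
      have := abs_sub_abs_le_abs_sub (g u k) (f u k)
      rw [abs_sub_comm] at this
      linarith [hu k]
    calc ENNReal.ofReal (|g u k| ^ p) = ENNReal.ofReal |g u k| ^ p :=
          (ENNReal.ofReal_rpow_of_nonneg (abs_nonneg _) hp'.le).symm
      _ ≤ (ENNReal.ofReal |f u k| + ENNReal.ofReal δ) ^ p := by
          rw [← ENNReal.ofReal_add (abs_nonneg _) hδ]
          exact ENNReal.rpow_le_rpow (ENNReal.ofReal_le_ofReal hk) hp'.le
      _ ≤ 2 ^ (p - 1) * (ENNReal.ofReal |f u k| ^ p + ENNReal.ofReal δ ^ p) :=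
          ENNReal.rpow_add_le_mul_rpow_add_rpow _ _ hp
      _ = _ := by rw [ENNReal.ofReal_rpow_of_nonneg (abs_nonneg _) hp'.le]
  · have h2 : (2 : ℝ≥0∞) ^ (p - 1) ≠ ⊤ :=
      ENNReal.rpow_ne_top_of_nonneg (by linarith) (by simp)
    have h3 : (N : ℝ≥0∞) * ENNReal.ofReal δ ^ p ≠ ⊤ :=
      ENNReal.mul_ne_top (by simp) (ENNReal.rpow_ne_top_of_nonneg hp'.le (by simp))
    rw [lintegral_const_mul' _ _ h2, lintegral_add_right _ measurable_const]
    refine ENNReal.mul_lt_top h2.lt_top (ENNReal.add_lt_top.2 ⟨hf, ?_⟩)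
    simpa using h3.lt_top

/-- The integrand of the `Ldist`-distance. -/
noncomputable def LdistCost (p : ℝ) {N : ℕ} (x y : Fin N → ℝ) : ℝ≥0∞ :=
  if p = 0 then cost0 x y else pCost p x y

lemma exists_lintegral_LdistCost_lt {N : ℕ} {p : ℝ} (hp : p = 0 ∨ 1 ≤ p) {η : ℝ≥0∞} (hη : 0 < η) :
    ∃ ε : ℝ≥0∞, 0 < ε ∧ ∀ f g : (Fin N → ℝ) → Fin N → ℝ, Ldist p f g < ε →
      ∫⁻ u, LdistCost p (f u) (g u) ∂lambdaN N < η := by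
  by_cases hp0 : p = 0
  · exact ⟨η, hη, fun f g h => by simpa [Ldist, LdistCost, hp0] using h⟩
  · have hp' : 0 < p := by linarith [hp.resolve_left hp0]
    have hi : 0 < p⁻¹ := inv_pos.2 hp'
    refine ⟨η ^ p⁻¹, ENNReal.rpow_pos_of_nonneg hη hi.le, fun f g h => ?_⟩
    simp only [Ldist, LdistCost, if_neg hp0] at h ⊢
    exact (ENNReal.rpow_lt_rpow_iff hi).1 h

lemma measurable_LdistCost {N : ℕ} (p : ℝ) {f g : (Fin N → ℝ) → Fin N → ℝ} (hf : Measurable f)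
    (hg : Measurable g) : Measurable fun u => LdistCost p (f u) (g u) := by
  unfold LdistCost cost0 pCost
  split_ifs <;> fun_prop

lemma tendsto_of_LdistCost {N : ℕ} {p : ℝ} (hp : p = 0 ∨ 1 ≤ p) {x : Fin N → ℝ}
    {y : ℕ → Fin N → ℝ} (h : Tendsto (fun n => LdistCost p x (y n)) atTop (𝓝 0)) :
    Tendsto y atTop (𝓝 x) := by
  refine tendsto_pi_nhds.2 fun k => ?_
  by_cases hp0 : p = 0
  · simp only [LdistCost, if_pos hp0, cost0] at h
    have h1 := (ENNReal.tendsto_toReal ENNReal.zero_ne_top).comp h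
    rw [Metric.tendsto_atTop]
    intro ε hε
    have h2 := h1.eventually_lt_const (show (0 : ℝ≥0∞).toReal < min ε 1 by simp [hε])
    obtain ⟨n₀, hn₀⟩ := eventually_atTop.1 h2
    refine ⟨n₀, fun n hn => ?_⟩
    have h3 := hn₀ n hn
    simp only [Function.comp] at h3
    rw [ENNReal.toReal_ofReal (le_min (norm_nonneg _) zero_le_one)] at h3
    have h4 : ‖x - y n‖ < ε := by
      rcases min_lt_iff.1 h3 with h | h
      · exact h.trans_le (min_le_left _ _)
      · exact absurd h (not_lt.2 (min_le_right _ _))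
    rw [dist_comm, Real.dist_eq]
    exact lt_of_le_of_lt (norm_le_pi_norm (x - y n) k) h4
  · have hp' : 0 < p := by linarith [hp.resolve_left hp0]
    simp only [LdistCost, if_neg hp0, pCost] at h
    have h1 : Tendsto (fun n => ENNReal.ofReal (|x k - y n k| ^ p)) atTop (𝓝 0) :=
      tendsto_of_tendsto_of_tendsto_of_le_of_le tendsto_const_nhds h (fun _ => zero_le)
        fun n => Finset.single_le_sum (f := fun k => ENNReal.ofReal (|x k - y n k| ^ p))
          (fun _ _ => zero_le) (Finset.mem_univ k)
    have h2 := (ENNReal.tendsto_toReal ENNReal.zero_ne_top).comp h1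
    have h3 := h2.rpow_const (p := p⁻¹) (Or.inr (inv_pos.2 hp').le)
    rw [ENNReal.toReal_zero, Real.zero_rpow (inv_pos.2 hp').ne'] at h3
    rw [tendsto_iff_dist_tendsto_zero]
    refine h3.congr fun n => ?_
    simp only [Function.comp]
    rw [ENNReal.toReal_ofReal (by positivity), Real.rpow_rpow_inv (abs_nonneg _) hp'.ne',
      dist_comm, Real.dist_eq]

/-- An a.e. limit of quantile processes is a.e. equal to an increasing triangular map. -/
lemma exists_increasingTriangular_of_tendsto {N : ℕ} {T : (Fin N → ℝ) → Fin N → ℝ}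
    {Q : ℕ → (Fin N → ℝ) → Fin N → ℝ} (hQ : ∀ n, IsQuantileProcess (Q n))
    (hlim : ∀ᵐ u ∂lambdaN N, Tendsto (fun n => Q n u) atTop (𝓝 (T u))) :
    ∃ S : (Fin N → ℝ) → Fin N → ℝ, IncreasingTriangular S ∧ T =ᵐ[lambdaN N] S := by
  classical
  have hQm : ∀ n k, Measurable fun u => Q n u k := fun n k =>
    (measurable_pi_apply k).comp (hQ n).measurable
  let C : Fin N → Set (Fin N → ℝ) := fun k => {u | ∃ l, Tendsto (fun n => Q n u k) atTop (𝓝 l)}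
  have hC : ∀ k, MeasurableSet (C k) := fun k =>
    measurableSet_exists_tendsto fun n => hQm n k
  let S : (Fin N → ℝ) → Fin N → ℝ := fun u k =>
    if u ∈ C k then limUnder atTop (fun n => Q n u k) else 0
  have hSlim : ∀ u k, u ∈ C k → Tendsto (fun n => Q n u k) atTop (𝓝 (S u k)) := by
    intro u k hu
    simp only [S, if_pos hu]
    exact tendsto_nhds_limUnder hu
  have hTk : ∀ᵐ u ∂lambdaN N, ∀ k, u ∈ C k := by
    filter_upwards [hlim] with u hu k
    exact ⟨_, tendsto_pi_nhds.1 hu k⟩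
  refine ⟨S, ⟨?_, ?_, cube N ∩ {u | ∀ k, u ∈ C k}, inter_subset_left, ?_, ?_⟩, ?_⟩
  · refine measurable_pi_lambda _ fun k => ?_
    refine measurable_of_tendsto_metrizable
      (f := fun n u => if u ∈ C k then Q n u k else 0)
      (fun n => Measurable.ite (hC k) (hQm n k) measurable_const) (tendsto_pi_nhds.2 fun u => ?_)
    by_cases hu : u ∈ C k
    · simpa only [if_pos hu] using hSlim u k hu
    · simp only [S, if_neg hu, tendsto_const_nhds]
  · intro k u v h
    have huv : (fun n => Q n u k) = fun n => Q n v k :=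
      funext fun n => (hQ n).triangular k u v h
    simp only [S, C, mem_ofPred_eq, huv]
  · exact mem_ae_iff.1 (inter_mem (ae_mem_cube N) hTk)
  · intro k u hu v hv h hk
    exact le_of_tendsto_of_tendsto' (hSlim u k (hu.2 k)) (hSlim v k (hv.2 k))
      fun n => (hQ n).inc k u hu.1 v hv.1 h hk
  · filter_upwards [hlim] with u hu
    funext k
    have hk := tendsto_pi_nhds.1 hu k
    exact tendsto_nhds_unique hk (hSlim u k ⟨_, hk⟩)

/-- For `p ∈ {0} ∪ [1,∞)`, the `L_p(λ^N)`-closure of the set of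
`p`-integrable quantile processes `{Q^μ : μ ∈ P_p(ℝ^N)}` is exactly the set `L^IT_p(λ^N)`
of `p`-integrable increasing triangular maps: a `p`-integrable `T` is a.e. equal to an
increasing triangular map iff it can be `L_p`-approximated by `p`-integrable quantile
processes. In particular the completion of `(P_p(ℝ^N), KR_p)` is `L^IT_p(λ^N)` up to
isometry. -/
theorem closure_Lquantile_eq_LIT (N : ℕ) (p : ℝ) (hp : p = 0 ∨ 1 ≤ p)
    (T : (Fin N → ℝ) → Fin N → ℝ) (hmeas : Measurable T) (hTp : FinLp p T) :
    (∃ S : (Fin N → ℝ) → Fin N → ℝ, IncreasingTriangular S ∧ T =ᵐ[lambdaN N] S) ↔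
      ∀ ε : ℝ≥0∞, 0 < ε → ∃ Q : (Fin N → ℝ) → Fin N → ℝ,
        IsQuantileProcess Q ∧ FinLp p Q ∧ Ldist p T Q < ε := by
  constructor
  · rintro ⟨S, hS, hTS⟩ ε hε
    have hlim : Tendsto (fun δ : ℝ => ((N : ℝ≥0∞) ^ p⁻¹ + 1) * ENNReal.ofReal δ) (𝓝[>] 0)
        (𝓝 0) := by
      have hc : (N : ℝ≥0∞) ^ p⁻¹ + 1 ≠ ⊤ := by
        refine ENNReal.add_ne_top.2 ⟨ENNReal.rpow_ne_top_of_nonneg ?_ (by simp), by simp⟩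
        rcases hp with rfl | hp
        · simp
        · exact inv_nonneg.2 (by linarith)
      have h1 : Tendsto ENNReal.ofReal (𝓝[>] 0) (𝓝 0) := by
        simpa using (ENNReal.tendsto_ofReal (tendsto_id (x := 𝓝 (0 : ℝ)))).mono_left
          nhdsWithin_le_nhds
      simpa using ENNReal.Tendsto.const_mul h1 (Or.inr hc)
    obtain ⟨δ, hδε, hδ⟩ :=
      ((hlim.eventually_lt_const hε).and self_mem_nhdsWithin).exists
    have hδ0 : 0 < δ := hδ
    have hclose : ∀ᵐ u ∂lambdaN N, ∀ k, |T u k - (rearrange S u + δ • u) k| ≤ δ := by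
      filter_upwards [hTS, rearrange_ae_eq hS, ae_mem_cube N] with u h1 h2 hu k
      have h3 := hu k
      rw [h1, h2, Pi.add_apply, Pi.smul_apply, smul_eq_mul, sub_add_cancel_left, abs_neg, abs_mul,
        abs_of_pos hδ0, abs_of_pos h3.1]
      exact mul_le_of_le_one_right hδ0.le h3.2.le
    exact ⟨fun u => rearrange S u + δ • u,
      isQuantileProcess_add_smul (measurable_rearrange hS.1) (triangular_rearrange hS.2.1)
        (incOn_rearrange hS.2.1) hδ0,
      hTp.of_ae_abs_sub_le hp hδ0.le hclose,
      (Ldist_le hp hδ0.le hclose).trans_lt hδε⟩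
  · intro h
    obtain ⟨η, hη, hsum⟩ := ENNReal.exists_pos_sum_of_countable' one_ne_zero ℕ
    have hex : ∀ n, ∃ Q : (Fin N → ℝ) → Fin N → ℝ, IsQuantileProcess Q ∧
        ∫⁻ u, LdistCost p (T u) (Q u) ∂lambdaN N < η n := by
      intro n
      obtain ⟨ε, hε, hlt⟩ := exists_lintegral_LdistCost_lt (N := N) hp (hη n)
      obtain ⟨Q, hQ, -, hd⟩ := h ε hε
      exact ⟨Q, hQ, hlt T Q hd⟩
    choose Q hQ hlt using hex
    refine exists_increasingTriangular_of_tendsto hQ ?_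
    have hm : ∀ n, Measurable fun u => LdistCost p (T u) (Q n u) := fun n =>
      measurable_LdistCost p hmeas (hQ n).measurable
    have hfin : ∫⁻ u, ∑' n, LdistCost p (T u) (Q n u) ∂lambdaN N ≠ ⊤ := by
      rw [lintegral_tsum fun n => (hm n).aemeasurable]
      exact ne_top_of_lt ((ENNReal.tsum_le_tsum fun n => (hlt n).le).trans_lt hsum)
    filter_upwards [ae_lt_top (Measurable.tsum hm) hfin] with u hu
    refine tendsto_of_LdistCost hp ?_
    exact ENNReal.tendsto_atTop_zero_of_tsum_ne_top hu.ne
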